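/- (Corollary for the Robin problem (P_R).) Let β and δ be real constants with β ≥ max(δ, −1−δ), set α = β − δ, and let k, a, h₀, γ, u_∞ > 0. Let ξ_R be the unique positive solution of (k·u_∞/(γ·2^{β+1}·a^{β+δ+2}))·f₁(z) = z^{β+δ+1}, where f₁(z) = 1/( (k/(2·a·h₀))·M(α/2 + 1/2, 1/2, z²) + z·M(α/2 + 1, 3/2, z²) ). Set D = (k/(2·a·h₀))·M(−α/2, 1/2, −ξ_R²) + ξ_R·M(−α/2 + 1/2, 3/2, −ξ_R²), C_{1R} = u_∞·ξ_R·M(−α/2 + 1/2, 3/2, −ξ_R²)/D, C_{2R} = −u_∞·M(−α/2, 1/2, −ξ_R²)/D, and define u_R(x,t) = t^{α/2}·[C_{1R}·M(−α/2, 1/2, −η²) + C_{2R}·η·M(−α/2 + 1/2, 3/2, −η²)] with η = x/(2a√t), and s_R(t) = 2ξ_R·a√t. Then: (i) ∂u_R/∂t = a²·∂²u_R/∂x² for all t > 0 and 0 < x < s_R(t); (ii) u_R(s_R(t),t) = 0 for all t > 0; (iii) −k·∂u_R/∂x(s_R(t),t) = γ·s_R(t)^β·ṡ_R(t)^δ·ṡ_R(t)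 for all t > 0; (iv) s_R(0) = 0; (v) k·∂u_R/∂x(0,t) = (h₀/√t)·(u_R(0,t) − u_∞·t^{α/2}) for all t > 0. -/

import Mathlib

/-- Kummer's confluent hypergeometric function
`M(a,b,z) = ∑ (a)_n / (b)_n · zⁿ/n!`, with `(a)_n` the rising factorial. -/
noncomputable def kummerM (a b z : ℝ) : ℝ :=
  ∑' n : ℕ, ((ascPochhammer ℝ n).eval a / (ascPochhammer ℝ n).eval b) * z ^ n / (n.factorial : ℝ)

lemma summable_derivSeries {c : ℕ → ℝ} (hc : ∀ r : ℝ, 0 ≤ r → Summable fun n => |c n| * r ^ n)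
    (r : ℝ) (hr : 0 ≤ r) : Summable fun n : ℕ => |((n : ℝ) + 1) * c (n + 1)| * r ^ n := by
  have h := (summable_nat_add_iff 1).2 (hc (2 * (r + 1)) (by positivity))
  refine Summable.of_nonneg_of_le (fun n => by positivity) (fun n => ?_) h
  rw [abs_mul, abs_of_nonneg (by positivity : (0 : ℝ) ≤ (n : ℝ) + 1)]
  have h1 : ((n : ℝ) + 1) ≤ 2 ^ n := by
    have : n + 1 ≤ 2 ^ n := Nat.lt_two_pow_self
    exact_mod_cast this
  have h2 : r ^ n ≤ (r + 1) ^ n := by gcongr; linarith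
  have h3 : ((n : ℝ) + 1) * r ^ n ≤ (2 * (r + 1)) ^ n := by
    rw [mul_pow]; gcongr
  have h4 : (2 * (r + 1)) ^ n ≤ (2 * (r + 1)) ^ (n + 1) :=
    pow_le_pow_right₀ (by linarith) (Nat.le_succ n)
  calc ((n : ℝ) + 1) * |c (n + 1)| * r ^ n = |c (n + 1)| * (((n : ℝ) + 1) * r ^ n) := by ring
    _ ≤ |c (n + 1)| * (2 * (r + 1)) ^ (n + 1) := by gcongr; linarith

lemma summable_entire {c : ℕ → ℝ} (hc : ∀ r : ℝ, 0 ≤ r → Summable fun n => |c n| * r ^ n)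
    (z : ℝ) : Summable fun n => c n * z ^ n := by
  refine Summable.of_norm ?_
  simpa [abs_mul, abs_pow] using hc |z| (abs_nonneg z)

lemma hasDerivAt_entire {c : ℕ → ℝ} (hc : ∀ r : ℝ, 0 ≤ r → Summable fun n => |c n| * r ^ n)
    (z : ℝ) : HasDerivAt (fun z => ∑' n, c n * z ^ n)
      (∑' n : ℕ, (((n : ℝ) + 1) * c (n + 1)) * z ^ n) z := by
  set R := |z| + 1 with hR
  have hR0 : 0 ≤ R := by positivity
  have hd := summable_derivSeries hc R hR0
  have hu : Summable fun n : ℕ => |(n : ℝ) * c n| * R ^ (n - 1) := by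
    rw [← summable_nat_add_iff 1]
    simpa using hd
  have key := hasDerivAt_tsum_of_isPreconnected (g := fun n z => c n * z ^ n)
    (g' := fun (n : ℕ) z => c n * ((n : ℝ) * z ^ (n - 1))) (t := Metric.ball 0 R) (y₀ := 0)
    (y := z) hu Metric.isOpen_ball (convex_ball _ _).isPreconnected
    (fun n y _ => (hasDerivAt_pow n y).const_mul (c n))
    (fun n y hy => by
      have hy' : |y| ≤ R := by simpa using (Metric.mem_ball.1 hy).le
      rw [Real.norm_eq_abs, ← mul_assoc, abs_mul, abs_pow, mul_comm (c n)]
      gcongr)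
    (by simp [hR]; positivity) (summable_entire hc 0) (by simp [hR])
  refine key.congr_deriv ?_
  have hs : Summable fun n : ℕ => c n * ((n : ℝ) * z ^ (n - 1)) := by
    rw [← summable_nat_add_iff 1]
    refine (summable_entire (summable_derivSeries hc) z).congr fun n => ?_
    push_cast [Nat.add_sub_cancel]; ring
  rw [hs.tsum_eq_zero_add]
  simp only [Nat.cast_zero, zero_mul, mul_zero, zero_add]
  refine tsum_congr fun n => ?_
  push_cast [Nat.add_sub_cancel]; ring

/-- The Taylor coefficients of `kummerM a b` at zero. -/
noncomputable def kummerCoeff (a b : ℝ) (n : ℕ) : ℝ :=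
  (ascPochhammer ℝ n).eval a / (ascPochhammer ℝ n).eval b / (n.factorial : ℝ)

lemma kummerM_eq_tsum (a b : ℝ) :
    kummerM a b = fun z => ∑' n, kummerCoeff a b n * z ^ n := by
  funext z
  refine tsum_congr fun n => ?_
  rw [kummerCoeff]; ring

lemma kummerCoeff_zero (a b : ℝ) : kummerCoeff a b 0 = 1 := by simp [kummerCoeff]

lemma kummerCoeff_succ (a : ℝ) {b : ℝ} (hb : 0 < b) (n : ℕ) :
    ((n : ℝ) + 1) * (b + n) * kummerCoeff a b (n + 1) = (a + n) * kummerCoeff a b n := by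
  have h1 : (ascPochhammer ℝ n).eval b ≠ 0 := (ascPochhammer_pos n b hb).ne'
  have h2 : b + n ≠ 0 := by positivity
  have h3 : (n.factorial : ℝ) ≠ 0 := by positivity
  simp only [kummerCoeff, ascPochhammer_succ_eval, Nat.factorial_succ]
  push_cast
  field_simp

lemma summable_kummerCoeff (a : ℝ) {b : ℝ} (hb : 0 < b) (r : ℝ) (hr : 0 ≤ r) :
    Summable fun n => |kummerCoeff a b n| * r ^ n := by
  refine summable_of_ratio_norm_eventually_le (r := 1 / 2) (by norm_num) ?_
  obtain ⟨N, hN⟩ := exists_nat_ge (2 * r * (|a| / b + 1))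
  filter_upwards [Filter.eventually_ge_atTop N] with n hn
  have hn' : 2 * r * (|a| / b + 1) ≤ (n : ℝ) + 1 := by
    have : (N : ℝ) ≤ n := by exact_mod_cast hn
    linarith
  have hbn : 0 < b + n := by positivity
  have h1 : |a + n| ≤ (|a| / b + 1) * (b + n) := by
    have : |a + n| ≤ |a| + n := by
      simpa using abs_add_le a (n : ℝ)
    have e : (|a| / b + 1) * (b + n) = |a| + n + (b + |a| / b * n) := by field_simp; ring
    have : 0 ≤ b + |a| / b * n := by positivity
    linarith
  have h2 : ((n : ℝ) + 1) * (b + n) * |kummerCoeff a b (n + 1)| =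
      |a + n| * |kummerCoeff a b n| := by
    have := congrArg abs (kummerCoeff_succ a hb n)
    rwa [abs_mul, abs_mul (a + n), abs_of_pos (by positivity : 0 < ((n : ℝ) + 1) * (b + n))] at this
  simp only [norm_mul, norm_pow, Real.norm_eq_abs, abs_abs, abs_of_nonneg hr]
  have h3 : ((n : ℝ) + 1) * |kummerCoeff a b (n + 1)| ≤
      (|a| / b + 1) * |kummerCoeff a b n| := by
    refine le_of_mul_le_mul_left ?_ hbn
    calc (b + n) * (((n : ℝ) + 1) * |kummerCoeff a b (n + 1)|)
        = |a + n| * |kummerCoeff a b n| := by rw [← h2]; ring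
      _ ≤ ((|a| / b + 1) * (b + n)) * |kummerCoeff a b n| := by gcongr
      _ = _ := by ring
  have hn1 : (0 : ℝ) < (n : ℝ) + 1 := by positivity
  refine le_of_mul_le_mul_left ?_ hn1
  calc ((n : ℝ) + 1) * (|kummerCoeff a b (n + 1)| * r ^ (n + 1))
      = (((n : ℝ) + 1) * |kummerCoeff a b (n + 1)|) * r ^ (n + 1) := by ring
    _ ≤ ((|a| / b + 1) * |kummerCoeff a b n|) * r ^ (n + 1) := by gcongr
    _ = (2 * r * (|a| / b + 1)) * (1 / 2 * (|kummerCoeff a b n| * r ^ n)) := by ring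
    _ ≤ ((n : ℝ) + 1) * (1 / 2 * (|kummerCoeff a b n| * r ^ n)) := by gcongr

/-- Kummer's equation `z M'' + (b - z) M' - a M = 0`. -/
lemma exists_kummerM_ode (a : ℝ) {b : ℝ} (hb : 0 < b) :
    ∃ M₁ M₂ : ℝ → ℝ, ∀ z, HasDerivAt (kummerM a b) (M₁ z) z ∧ HasDerivAt M₁ (M₂ z) z ∧
      z * M₂ z + (b - z) * M₁ z - a * kummerM a b z = 0 := by
  have hc := summable_kummerCoeff a hb
  have hc1 := summable_derivSeries hc
  have hc2 := summable_derivSeries hc1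
  refine ⟨_, _, fun z => ⟨?_, hasDerivAt_entire hc1 z, ?_⟩⟩
  · rw [kummerM_eq_tsum]
    exact hasDerivAt_entire hc z
  · rw [kummerM_eq_tsum]
    have s0 := (summable_entire hc z).hasSum
    have s1 := (summable_entire hc1 z).hasSum
    have s2 := (summable_entire hc2 z).hasSum
    have t1 : HasSum (fun n : ℕ => (n : ℝ) * kummerCoeff a b n * z ^ n)
        (z * ∑' n : ℕ, (((n : ℝ) + 1) * kummerCoeff a b (n + 1)) * z ^ n) := by
      rw [← hasSum_nat_add_iff' 1]
      simp only [Finset.sum_range_one, Nat.cast_zero, zero_mul, sub_zero]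
      refine (s1.mul_left z).congr_fun fun n => ?_
      push_cast; ring
    have t2 : HasSum (fun n : ℕ => (n : ℝ) * (((n : ℝ) + 1) * kummerCoeff a b (n + 1)) * z ^ n)
        (z * ∑' n : ℕ, (((n : ℝ) + 1) * ((((n + 1 : ℕ) : ℝ) + 1) * kummerCoeff a b (n + 1 + 1)))
          * z ^ n) := by
      rw [← hasSum_nat_add_iff' 1]
      simp only [Finset.sum_range_one, Nat.cast_zero, zero_mul, sub_zero]
      refine (s2.mul_left z).congr_fun fun n => ?_
      push_cast; ring
    have t := ((t2.add (s1.mul_left b)).sub t1).sub (s0.mul_left a)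
    have t0 := t.unique ((hasSum_zero (α := ℝ) (β := ℕ)).congr_fun fun n => by
      have := kummerCoeff_succ a hb n
      linear_combination z ^ n * this)
    linear_combination t0

lemma kummerM_zero (a b : ℝ) : kummerM a b 0 = 1 := by
  rw [kummerM_eq_tsum]
  dsimp only
  rw [tsum_eq_single 0 fun n hn => by simp [hn]]
  simp [kummerCoeff_zero]

lemma kummerM_pos {a b z : ℝ} (ha : 0 < a) (hb : 0 < b) (hz : 0 ≤ z) : 0 < kummerM a b z := by
  rw [kummerM_eq_tsum]
  refine (summable_entire (summable_kummerCoeff a hb) z).tsum_pos (fun n => ?_) 0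
    (by simp [kummerCoeff_zero])
  have h1 := ascPochhammer_pos n a ha
  have h2 := ascPochhammer_pos n b hb
  rw [kummerCoeff]
  positivity

/-- `y` solves `y'' + 2 η y' = c y` on the real line, with derivative `y'`. -/
def IsSimilaritySol (c : ℝ) (y y' : ℝ → ℝ) : Prop :=
  ∀ η, HasDerivAt y (y' η) η ∧ HasDerivAt y' (-2 * η * y' η + c * y η) η

lemma IsSimilaritySol.wronskian {c : ℝ} {y y' w w' : ℝ → ℝ} (hy : IsSimilaritySol c y y')
    (hw : IsSimilaritySol c w w') (η : ℝ) :
    y η * w' η - y' η * w η = (y 0 * w' 0 - y' 0 * w 0) * Real.exp (-η ^ 2) := by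
  have hd : ∀ x, HasDerivAt (fun x => (y x * w' x - y' x * w x) * Real.exp (x ^ 2)) 0 x := by
    intro x
    have h := ((((hy x).1.mul (hw x).2).sub ((hy x).2.mul (hw x).1))).mul
      ((hasDerivAt_pow 2 x).exp)
    refine h.congr_deriv ?_
    simp only [Pi.mul_apply, Pi.sub_apply]
    push_cast
    ring
  have h := is_const_of_deriv_eq_zero (fun x => (hd x).differentiableAt)
    (fun x => (hd x).deriv) η 0
  simp only [ne_eq, OfNat.ofNat_ne_zero, not_false_eq_true, zero_pow, Real.exp_zero, mul_one] at h
  rw [← h, mul_assoc, ← Real.exp_add]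
  simp

lemma IsSimilaritySol.eq_of_initial {c : ℝ} {y y' w w' v v' : ℝ → ℝ}
    (hy : IsSimilaritySol c y y') (hw : IsSimilaritySol c w w') (hv : IsSimilaritySol c v v')
    (h0 : y 0 = w 0) (h1 : y' 0 = w' 0) (hne : y 0 * v' 0 - y' 0 * v 0 ≠ 0) (η : ℝ) :
    y η = w η := by
  have e1 := hy.wronskian hv η
  have e2 := hw.wronskian hv η
  have e3 := hy.wronskian hw η
  rw [← h0, ← h1] at e2 e3
  have e4 : (y 0 * v' 0 - y' 0 * v 0) * Real.exp (-η ^ 2) * (y η - w η) = 0 := by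
    linear_combination w η * e1 - y η * e2 - v η * e3
  have := (mul_eq_zero.1 e4).resolve_left (mul_ne_zero hne (Real.exp_pos _).ne')
  linarith

lemma hasDerivAt_neg_sq (η : ℝ) : HasDerivAt (fun η : ℝ => -η ^ 2) (-(2 * η)) η := by
  simpa using (hasDerivAt_pow 2 η).fun_neg

lemma exists_even_sol (p : ℝ) :
    ∃ y', IsSimilaritySol (-4 * p) (fun η => kummerM p (1 / 2) (-η ^ 2)) y' ∧ y' 0 = 0 := by
  obtain ⟨M₁, M₂, h⟩ := exists_kummerM_ode p (b := 1 / 2) (by norm_num)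
  refine ⟨fun η => M₁ (-η ^ 2) * (-(2 * η)), fun η => ⟨?_, ?_⟩, by simp⟩
  · have hq := hasDerivAt_neg_sq η
    exact (h (-η ^ 2)).1.comp η hq
  · have hq := hasDerivAt_neg_sq η
    refine (((h (-η ^ 2)).2.1.comp η hq).mul ((hasDerivAt_id η).const_mul 2).neg).congr_deriv ?_
    have := (h (-η ^ 2)).2.2
    simp only [Function.comp, id, Pi.neg_apply]
    linear_combination (-4) * this

lemma exists_odd_sol (p : ℝ) :
    ∃ y', IsSimilaritySol (-4 * p) (fun η => η * kummerM (p + 1 / 2) (3 / 2) (-η ^ 2)) y' ∧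
      y' 0 = 1 := by
  obtain ⟨M₁, M₂, h⟩ := exists_kummerM_ode (p + 1 / 2) (b := 3 / 2) (by norm_num)
  refine ⟨fun η => 1 * kummerM (p + 1 / 2) (3 / 2) (-η ^ 2) + η * (M₁ (-η ^ 2) * (-(2 * η))),
    fun η => ⟨?_, ?_⟩, by simp [kummerM_zero]⟩
  · have hq := hasDerivAt_neg_sq η
    have hM : HasDerivAt (fun η => kummerM (p + 1 / 2) (3 / 2) (-η ^ 2))
        (M₁ (-η ^ 2) * (-(2 * η))) η :=
      HasDerivAt.comp (h₂ := kummerM (p + 1 / 2) (3 / 2)) η (h (-η ^ 2)).1 hq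
    exact (hasDerivAt_id η).mul hM
  · have hq := hasDerivAt_neg_sq η
    refine ((((h (-η ^ 2)).1.comp η hq).const_mul 1).add ((hasDerivAt_id η).mul
      (((h (-η ^ 2)).2.1.comp η hq).mul ((hasDerivAt_id η).const_mul 2).neg))).congr_deriv ?_
    have := (h (-η ^ 2)).2.2
    simp only [Function.comp, id, Pi.neg_apply, Pi.mul_apply]
    linear_combination (-4) * η * this

/-- Multiplying by `exp (-η²)` reflects a solution `N` of the equation `N'' - 2 η N' = d N`. -/
lemma isSimilaritySol_exp_mul {d : ℝ} {N N' : ℝ → ℝ}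
    (h : ∀ η, HasDerivAt N (N' η) η ∧ HasDerivAt N' (2 * η * N' η + d * N η) η) :
    IsSimilaritySol (d - 2) (fun η => Real.exp (-η ^ 2) * N η)
      (fun η => Real.exp (-η ^ 2) * (N' η - 2 * η * N η)) := by
  intro η
  have hq : HasDerivAt (fun η : ℝ => Real.exp (-η ^ 2)) (Real.exp (-η ^ 2) * (-(2 * η))) η := by
    exact (hasDerivAt_neg_sq η).exp
  constructor
  · refine (hq.mul (h η).1).congr_deriv ?_
    ring
  · refine (hq.mul ((h η).2.sub (((hasDerivAt_id η).const_mul 2).mul (h η).1))).congr_deriv ?_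
    simp only [id, Pi.sub_apply, Pi.mul_apply]
    ring

lemma exists_even_sol_exp (q : ℝ) :
    ∃ y', IsSimilaritySol (4 * q - 2)
      (fun η => Real.exp (-η ^ 2) * kummerM q (1 / 2) (η ^ 2)) y' ∧ y' 0 = 0 := by
  obtain ⟨M₁, M₂, h⟩ := exists_kummerM_ode q (b := 1 / 2) (by norm_num)
  refine ⟨_, isSimilaritySol_exp_mul (N' := fun η => M₁ (η ^ 2) * (2 * η))
    fun η => ⟨?_, ?_⟩, by simp⟩
  · have hq : HasDerivAt (fun η : ℝ => η ^ 2) (2 * η) η := by simpa using hasDerivAt_pow 2 η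
    exact (h (η ^ 2)).1.comp η hq
  · have hq : HasDerivAt (fun η : ℝ => η ^ 2) (2 * η) η := by simpa using hasDerivAt_pow 2 η
    refine (((h (η ^ 2)).2.1.comp η hq).mul ((hasDerivAt_id η).const_mul 2)).congr_deriv ?_
    have := (h (η ^ 2)).2.2
    simp only [Function.comp, id]
    linear_combination 4 * this

lemma exists_odd_sol_exp (q : ℝ) :
    ∃ y', IsSimilaritySol (4 * q - 4)
      (fun η => Real.exp (-η ^ 2) * (η * kummerM q (3 / 2) (η ^ 2))) y' ∧ y' 0 = 1 := by
  obtain ⟨M₁, M₂, h⟩ := exists_kummerM_ode q (b := 3 / 2) (by norm_num)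
  have key := isSimilaritySol_exp_mul (d := 4 * q - 2)
    (N := fun η => η * kummerM q (3 / 2) (η ^ 2))
    (N' := fun η => 1 * kummerM q (3 / 2) (η ^ 2) + η * (M₁ (η ^ 2) * (2 * η)))
    fun η => by
      have hq : HasDerivAt (fun η : ℝ => η ^ 2) (2 * η) η := by simpa using hasDerivAt_pow 2 η
      have hM : HasDerivAt (fun η => kummerM q (3 / 2) (η ^ 2))
        (M₁ (η ^ 2) * (2 * η)) η :=
        HasDerivAt.comp (h₂ := kummerM q (3 / 2)) η (h (η ^ 2)).1 hq
      refine ⟨(hasDerivAt_id η).mul hM, ?_⟩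
      refine ((((h (η ^ 2)).1.comp η hq).const_mul 1).add ((hasDerivAt_id η).mul
        (((h (η ^ 2)).2.1.comp η hq).mul ((hasDerivAt_id η).const_mul 2)))).congr_deriv ?_
      have := (h (η ^ 2)).2.2
      simp only [Function.comp, id, Pi.mul_apply]
      linear_combination 4 * η * this
  rw [show 4 * q - 2 - 2 = 4 * q - 4 by ring] at key
  exact ⟨_, key, by simp [kummerM_zero]⟩

/-- Kummer's transformation at `b = 1/2`. -/
lemma kummerM_half_neg_sq (p ξ : ℝ) :
    kummerM p (1 / 2) (-ξ ^ 2) = Real.exp (-ξ ^ 2) * kummerM (1 / 2 - p) (1 / 2) (ξ ^ 2) := by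
  obtain ⟨y', hy, hy0⟩ := exists_even_sol p
  obtain ⟨v', hv, hv0⟩ := exists_odd_sol p
  obtain ⟨w', hw, hw0⟩ := exists_even_sol_exp (1 / 2 - p)
  rw [show 4 * (1 / 2 - p) - 2 = -4 * p by ring] at hw
  exact hy.eq_of_initial hw hv (by simp [kummerM_zero]) (by rw [hy0, hw0])
    (by simp [hy0, hv0, kummerM_zero]) ξ

/-- Kummer's transformation at `b = 3/2`, multiplied by the variable. -/
lemma mul_kummerM_three_half_neg_sq (p ξ : ℝ) :
    ξ * kummerM (p + 1 / 2) (3 / 2) (-ξ ^ 2) =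
      Real.exp (-ξ ^ 2) * (ξ * kummerM (1 - p) (3 / 2) (ξ ^ 2)) := by
  obtain ⟨v', hv, hv0⟩ := exists_even_sol p
  obtain ⟨y', hy, hy0⟩ := exists_odd_sol p
  obtain ⟨w', hw, hw0⟩ := exists_odd_sol_exp (1 - p)
  rw [show 4 * (1 - p) - 4 = -4 * p by ring] at hw
  exact hy.eq_of_initial hw hv (by simp) (by rw [hy0, hw0])
    (by simp [hy0, hv0, kummerM_zero]) ξ

lemma IsSimilaritySol.linear_comb {c : ℝ} {y y' w w' : ℝ → ℝ} (hy : IsSimilaritySol c y y')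
    (hw : IsSimilaritySol c w w') (A B : ℝ) :
    IsSimilaritySol c (fun η => A * y η + B * w η) (fun η => A * y' η + B * w' η) := by
  intro η
  refine ⟨((hy η).1.const_mul A).add ((hw η).1.const_mul B),
    (((hy η).2.const_mul A).add ((hw η).2.const_mul B)).congr_deriv ?_⟩
  ring

lemma IsSimilaritySol.hasDerivAt_space {c : ℝ} {y y' : ℝ → ℝ} (hy : IsSimilaritySol c y y')
    (A l x : ℝ) : HasDerivAt (fun x => A * y (x / l)) (A * (y' (x / l) / l)) x := by
  have hq : HasDerivAt (fun x : ℝ => x / l) (1 / l) x := (hasDerivAt_id x).div_const l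
  refine (((hy (x / l)).1.comp x hq).const_mul A).congr_deriv ?_
  ring

lemma IsSimilaritySol.hasDerivAt_space' {c : ℝ} {y y' : ℝ → ℝ} (hy : IsSimilaritySol c y y')
    (A l x : ℝ) : HasDerivAt (fun x => A * (y' (x / l) / l))
      (A * ((-2 * (x / l) * y' (x / l) + c * y (x / l)) / l ^ 2)) x := by
  have hq : HasDerivAt (fun x : ℝ => x / l) (1 / l) x := (hasDerivAt_id x).div_const l
  refine ((((hy (x / l)).2.comp x hq).div_const l).const_mul A).congr_deriv ?_
  ring

lemma IsSimilaritySol.heat_equation {α : ℝ} {y y' : ℝ → ℝ} (hy : IsSimilaritySol (2 * α) y y')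
    {a t : ℝ} (ha : 0 < a) (ht : 0 < t) (x : ℝ) :
    deriv (fun τ : ℝ => τ ^ (α / 2) * y (x / (2 * a * Real.sqrt τ))) t =
      a ^ 2 * deriv (deriv fun x => t ^ (α / 2) * y (x / (2 * a * Real.sqrt t))) x := by
  have hs : 0 < Real.sqrt t := Real.sqrt_pos.2 ht
  have hss : Real.sqrt t ^ 2 = t := Real.sq_sqrt ht.le
  have e : (deriv fun x => t ^ (α / 2) * y (x / (2 * a * Real.sqrt t))) =
      fun x => t ^ (α / 2) * (y' (x / (2 * a * Real.sqrt t)) / (2 * a * Real.sqrt t)) :=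
    funext fun x => (hy.hasDerivAt_space _ _ x).deriv
  rw [e, (hy.hasDerivAt_space' _ _ x).deriv]
  have hq : HasDerivAt (fun τ : ℝ => x / (2 * a * Real.sqrt τ))
      (-(x / (2 * a * Real.sqrt t)) / (2 * t)) t := by
    refine ((hasDerivAt_const t x).div ((Real.hasDerivAt_sqrt ht.ne').const_mul (2 * a))
      (by positivity)).congr_deriv ?_
    nth_rewrite 5 [← hss]
    field_simp
    ring
  have hp : HasDerivAt (fun τ : ℝ => τ ^ (α / 2)) (α / 2 * t ^ (α / 2) / t) t := by
    refine (Real.hasDerivAt_rpow_const (Or.inl ht.ne')).congr_deriv ?_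
    rw [Real.rpow_sub_one ht.ne']; ring
  have hyq : HasDerivAt (fun τ : ℝ => y (x / (2 * a * Real.sqrt τ))) _ t := (hy _).1.comp t hq
  rw [(hp.fun_mul hyq).deriv, mul_pow (2 * a), hss]
  field_simp
  ring

/-- Corollary (Robin problem (P_R)): with `β ≥ max(δ,−1−δ)`, `α = β − δ`, `ξ_R` the
positive root of `(k·u_∞/(γ·2^{β+1}·a^{β+δ+2}))·f₁(z) = z^{β+δ+1}`, the similarity pair
`(u_R, s_R)` solves the Stefan-like problem with the Robin condition
`k·∂u/∂x(0,t) = (h₀/√t)·(u(0,t) − u_∞·t^{α/2})` at the fixed face. -/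
theorem stmt10 (β δ k a h₀ γ uinf : ℝ) (hβ : β ≥ max δ (-1 - δ))
    (hk : 0 < k) (ha : 0 < a) (hh : 0 < h₀) (hγ : 0 < γ) (huinf : 0 < uinf)
    (α : ℝ) (hα : α = β - δ)
    (ξR : ℝ) (hξpos : 0 < ξR)
    (hξ : (k * uinf / (γ * (2:ℝ) ^ (β + 1) * a ^ (β + δ + 2))) *
      (1 / ((k / (2 * a * h₀)) * kummerM (α/2 + 1/2) (1/2) (ξR^2) +
        ξR * kummerM (α/2 + 1) (3/2) (ξR^2))) = ξR ^ (β + δ + 1))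
    (D C₁R C₂R : ℝ)
    (hD : D = (k / (2 * a * h₀)) * kummerM (-α/2) (1/2) (-ξR^2) +
      ξR * kummerM (-α/2 + 1/2) (3/2) (-ξR^2))
    (hC₁ : C₁R = uinf * ξR * kummerM (-α/2 + 1/2) (3/2) (-ξR^2) / D)
    (hC₂ : C₂R = -uinf * kummerM (-α/2) (1/2) (-ξR^2) / D)
    (uR : ℝ → ℝ → ℝ)
    (hu : uR = fun x t => t ^ (α/2) *
      (C₁R * kummerM (-α/2) (1/2) (-(x / (2 * a * Real.sqrt t))^2) +
       C₂R * (x / (2 * a * Real.sqrt t)) *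
         kummerM (-α/2 + 1/2) (3/2) (-(x / (2 * a * Real.sqrt t))^2)))
    (sR : ℝ → ℝ) (hs : sR = fun t => 2 * ξR * a * Real.sqrt t) :
    (∀ t x : ℝ, 0 < t → 0 < x → x < sR t →
      deriv (fun τ => uR x τ) t = a^2 * deriv (deriv (fun y => uR y t)) x) ∧
    (∀ t : ℝ, 0 < t → uR (sR t) t = 0) ∧
    (∀ t : ℝ, 0 < t → -k * deriv (fun y => uR y t) (sR t) =
      γ * (sR t) ^ β * (deriv sR t) ^ δ * deriv sR t) ∧
    sR 0 = 0 ∧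
    (∀ t : ℝ, 0 < t → k * deriv (fun y => uR y t) 0 =
      (h₀ / Real.sqrt t) * (uR 0 t - uinf * t ^ (α/2))) := by
  have hα0 : 0 ≤ α := by
    have := (le_max_left δ (-1 - δ)).trans hβ
    linarith
  obtain ⟨e', he, he0⟩ := exists_even_sol (-α / 2)
  obtain ⟨o', ho, ho0⟩ := exists_odd_sol (-α / 2)
  rw [show -4 * (-α / 2) = 2 * α by ring] at he ho
  have hg := he.linear_comb ho C₁R C₂R
  set g : ℝ → ℝ := fun η => C₁R * kummerM (-α / 2) (1 / 2) (-η ^ 2) +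
    C₂R * (η * kummerM (-α / 2 + 1 / 2) (3 / 2) (-η ^ 2)) with hgdef
  have hu' : uR = fun x t => t ^ (α / 2) * g (x / (2 * a * Real.sqrt t)) := by
    rw [hu, hgdef]
    funext x t
    ring
  have hE := kummerM_half_neg_sq (-α / 2) ξR
  have hO := mul_kummerM_three_half_neg_sq (-α / 2) ξR
  have hW := he.wronskian ho ξR
  rw [he0, ho0] at hW
  simp only [ne_eq, OfNat.ofNat_ne_zero, not_false_eq_true, zero_pow, neg_zero, kummerM_zero,
    mul_one, zero_mul, sub_zero, one_mul] at hW
  rw [show (1 : ℝ) / 2 - -α / 2 = α / 2 + 1 / 2 by ring] at hE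
  rw [show (1 : ℝ) - -α / 2 = α / 2 + 1 by ring] at hO
  have hP1 : 0 < kummerM (α / 2 + 1 / 2) (1 / 2) (ξR ^ 2) :=
    kummerM_pos (by linarith) (by norm_num) (by positivity)
  have hP2 : 0 < kummerM (α / 2 + 1) (3 / 2) (ξR ^ 2) :=
    kummerM_pos (by linarith) (by norm_num) (by positivity)
  set Q := k / (2 * a * h₀) * kummerM (α / 2 + 1 / 2) (1 / 2) (ξR ^ 2) +
    ξR * kummerM (α / 2 + 1) (3 / 2) (ξR ^ 2) with hQ
  have hQ0 : 0 < Q := by positivity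
  have hDQ : D = Real.exp (-ξR ^ 2) * Q := by
    rw [hD, hE, hO, hQ]; ring
  have hD0 : D ≠ 0 := by rw [hDQ]; positivity
  have hexp := (Real.exp_pos (-ξR ^ 2)).ne'
  have hgξ : g ξR = 0 := by
    simp only [hgdef, hC₁, hC₂]; ring
  have hgξ' : C₁R * e' ξR + C₂R * o' ξR = -uinf / Q := by
    have h1 : C₁R * e' ξR + C₂R * o' ξR = -uinf * Real.exp (-ξR ^ 2) / D := by
      rw [← hW, hC₁, hC₂]; ring
    rw [h1, hDQ]; field_simp
  have harg : ∀ t : ℝ, 0 < t → sR t / (2 * a * Real.sqrt t) = ξR := by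
    intro t ht
    have hst : 0 < Real.sqrt t := Real.sqrt_pos.2 ht
    rw [hs]; field_simp
  subst hu'
  refine ⟨fun t x ht _ _ => hg.heat_equation ha ht x, fun t ht => ?_, fun t ht => ?_, ?_,
    fun t ht => ?_⟩
  · simp only [harg t ht, hgξ, mul_zero]
  · have hst : 0 < Real.sqrt t := Real.sqrt_pos.2 ht
    have hst2 : Real.sqrt t ^ 2 = t := Real.sq_sqrt ht.le
    have hd : deriv sR t = ξR * a / Real.sqrt t := by
      rw [hs, ((Real.hasDerivAt_sqrt ht.ne').const_mul (2 * ξR * a)).deriv]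
      field_simp
    rw [(hg.hasDerivAt_space (t ^ (α / 2)) (2 * a * Real.sqrt t) (sR t)).deriv, harg t ht, hgξ', hd,
      hs]
    dsimp only
    set r := Real.sqrt t
    have ht2 : t ^ (α / 2) = r ^ α := by
      rw [← hst2, ← Real.rpow_natCast, ← Real.rpow_mul hst.le]
      congr 1
      push_cast; ring
    have hflux : k * uinf / Q = γ * 2 ^ (β + 1) * a ^ (β + δ + 2) * ξR ^ (β + δ + 1) := by
      have h2 : (0 : ℝ) < 2 ^ (β + 1) := by positivity
      have h3 : 0 < a ^ (β + δ + 2) := by positivity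
      rw [← hξ]; field_simp
    rw [ht2, show 2 * ξR * a * r = 2 * (ξR * a) * r by ring,
      Real.mul_rpow (by positivity) hst.le, Real.mul_rpow (by norm_num) (by positivity),
      Real.div_rpow (by positivity) hst.le, Real.mul_rpow hξpos.le ha.le,
      Real.mul_rpow hξpos.le ha.le, hα, Real.rpow_sub hst]
    rw [Real.rpow_add_one (by norm_num), show β + δ + 2 = β + δ + 1 + 1 by ring,
      Real.rpow_add_one ha.ne', Real.rpow_add_one ha.ne', Real.rpow_add_one hξpos.ne',
      Real.rpow_add ha, Real.rpow_add hξpos] at hflux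
    have hrδ : 0 < r ^ δ := by positivity
    rw [show -k * (r ^ β / r ^ δ * (-uinf / Q / (2 * a * r))) =
      k * uinf / Q * (r ^ β / r ^ δ / (2 * a * r)) by ring, hflux]
    field_simp
  · simp [hs]
  · have hst : 0 < Real.sqrt t := Real.sqrt_pos.2 ht
    rw [(hg.hasDerivAt_space (t ^ (α / 2)) (2 * a * Real.sqrt t) 0).deriv]
    simp only [zero_div, he0, ho0, hgdef, ne_eq, OfNat.ofNat_ne_zero, not_false_eq_true, zero_pow,
      neg_zero, kummerM_zero, mul_zero, mul_one, add_zero, zero_add]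
    have hC : h₀ * (C₁R - uinf) = k * C₂R / (2 * a) := by
      have h1 : C₁R * D = uinf * ξR * kummerM (-α / 2 + 1 / 2) (3 / 2) (-ξR ^ 2) := by
        rw [hC₁]; field_simp
      have h2 : C₂R * D = -uinf * kummerM (-α / 2) (1 / 2) (-ξR ^ 2) := by
        rw [hC₂]; field_simp
      refine mul_right_cancel₀ hD0 ?_
      rw [show k * C₂R / (2 * a) * D = k / (2 * a) * (C₂R * D) by ring, h2,
        show h₀ * (C₁R - uinf) * D = h₀ * (C₁R * D - uinf * D) by ring, h1, hD]
      field_simp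
      ring
    rw [show h₀ / Real.sqrt t * (t ^ (α / 2) * C₁R - uinf * t ^ (α / 2)) =
      t ^ (α / 2) / Real.sqrt t * (h₀ * (C₁R - uinf)) by ring, hC]
    field_simp
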